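/- arXiv:2010.12914 — 2 statements merged into one kernel-verified Lean document; each statement's English description precedes it below -/
import Mathlib

section
/- Let S and A be finite nonempty types, f, f̂ : S → A → PMF S two transition kernels (real and learned dynamics), π : S → PMF A a policy, (s₀, a₀) a fixed initial state-action pair, γ ∈ [0,1) a discount factor, and H ≥ 1 a horizon. Let r_e, r_m : S → A → ℝ be reward functions. Assume: (i) |r_e(s,a) − r_m(s,a)| ≤ ε_r for all s, a; (ii) |r_e(s,a)| ≤ r_max for all s, a; and (iii) for every t with 1 ≤ t ≤ H−1, the total variation distance between the time-t state-action marginals under f and f̂ satisfies D_TV(ρ_t^f, ρ_t^{f̂}) ≤ ε_m. Then the trajectory reward estimation (TREE) error satisfies J^f(r_e) − J^{f̂}(r_m) ≤ (1 − γ^H)·ε_r/(1 − γ) + 2·r_max·(γ − γ^H)·ε_m/(1 − γ). -/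
open Finset

/-- Total variation distance between two PMFs on a finite type:
`D_TV(p,q) = (1/2) * Σ_x |p(x) - q(x)|`. -/
noncomputable def tv {X : Type*} [Fintype X] (p q : PMF X) : ℝ :=
  (1 / 2) * ∑ x, |(p x).toReal - (q x).toReal|

/-- One transition step: from `(s,a)` sample `s' ∼ g s a` and `a' ∼ π s'`. -/
noncomputable def step {S A : Type*} (g : S → A → PMF S) (π : S → PMF A)
    (s : S) (a : A) : PMF (S × A) :=
  (g s a).bind fun s' => (π s').map fun a' => (s', a')

/-- Time-`t` state-action marginal starting from `(s₀,a₀)`: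
`rho g π s₀ a₀ 1 = (g s₀ a₀).bind (fun s => (π s).map (fun a => (s,a)))` and
`rho g π s₀ a₀ (t+1) = (rho g π s₀ a₀ t).bind (fun (s,a) => step g π s a)`. -/
noncomputable def rho {S A : Type*} (g : S → A → PMF S) (π : S → PMF A)
    (s₀ : S) (a₀ : A) : ℕ → PMF (S × A)
  | 0 => PMF.pure (s₀, a₀)
  | t + 1 => (rho g π s₀ a₀ t).bind fun sa => step g π sa.1 sa.2

/-- `H`-step expected discounted return:
`J^g(r) = r(s₀,a₀) + Σ_{t=1}^{H-1} γ^t · E_{(s,a) ∼ ρ_t^g}[r(s,a)]`. -/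
noncomputable def J {S A : Type*} [Fintype S] [Fintype A]
    (g : S → A → PMF S) (π : S → PMF A) (s₀ : S) (a₀ : A)
    (r : S → A → ℝ) (γ : ℝ) (H : ℕ) : ℝ :=
  r s₀ a₀ + ∑ t ∈ Finset.Icc 1 (H - 1),
    γ ^ t * ∑ sa : S × A, ((rho g π s₀ a₀ t) sa).toReal * r sa.1 sa.2

/-- The difference of expectations of a function bounded by `B` is at most `2 * B * tv p q`. -/
lemma sum_mul_sub_sum_mul_le_tv {X : Type*} [Fintype X] (p q : PMF X) (u : X → ℝ) (B : ℝ)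
    (hu : ∀ x, |u x| ≤ B) :
    ∑ x, (p x).toReal * u x - ∑ x, (q x).toReal * u x ≤ 2 * B * tv p q := by
  have h : 2 * B * tv p q = ∑ x, |(p x).toReal - (q x).toReal| * B := by
    rw [tv, ← Finset.sum_mul]
    ring
  rw [h, ← Finset.sum_sub_distrib]
  refine Finset.sum_le_sum fun x _ => ?_
  rw [← sub_mul]
  calc _ ≤ |((p x).toReal - (q x).toReal) * u x| := le_abs_self _
    _ = |(p x).toReal - (q x).toReal| * |u x| := abs_mul _ _
    _ ≤ _ := by gcongr; exact hu x

lemma PMF.sum_toReal_eq_one {X : Type*} [Fintype X] (p : PMF X) :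
    ∑ x, (p x).toReal = 1 := by
  rw [← ENNReal.toReal_sum fun x _ => p.apply_ne_top x, ← tsum_fintype (L := .unconditional X),
    p.tsum_coe, ENNReal.toReal_one]

lemma PMF.sum_toReal_mul_le {X : Type*} [Fintype X] (p : PMF X) (u : X → ℝ) (B : ℝ)
    (hu : ∀ x, u x ≤ B) : ∑ x, (p x).toReal * u x ≤ B := by
  calc _ ≤ ∑ x, (p x).toReal * B := by gcongr with x; exact hu x
    _ = B := by rw [← Finset.sum_mul, p.sum_toReal_eq_one, one_mul]

lemma sum_mul_sub_sum_mul_le {X : Type*} [Fintype X] (p q : PMF X) (u v : X → ℝ) (B ε : ℝ)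
    (hu : ∀ x, |u x| ≤ B) (huv : ∀ x, |u x - v x| ≤ ε) :
    ∑ x, (p x).toReal * u x - ∑ x, (q x).toReal * v x ≤ ε + 2 * B * tv p q := by
  have h₁ := sum_mul_sub_sum_mul_le_tv p q u B hu
  have h₂ := q.sum_toReal_mul_le (fun x => u x - v x) ε fun x => (le_abs_self _).trans (huv x)
  simp only [mul_sub, Finset.sum_sub_distrib] at h₂
  linarith

lemma sum_Icc_one_pow {γ : ℝ} (hγ : γ ≠ 1) (n : ℕ) :
    ∑ t ∈ Finset.Icc 1 n, γ ^ t = (γ - γ ^ (n + 1)) / (1 - γ) := by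
  have : 1 - γ ≠ 0 := sub_ne_zero.mpr hγ.symm
  induction n with
  | zero => simp
  | succ n ih =>
    rw [Finset.sum_Icc_succ_top (by omega), ih]
    field_simp
    ring

theorem tree_error_bound {S A : Type*} [Fintype S] [Fintype A] [Nonempty S] [Nonempty A]
    (f fhat : S → A → PMF S) (π : S → PMF A) (s₀ : S) (a₀ : A)
    (γ : ℝ) (hγ0 : 0 ≤ γ) (hγ1 : γ < 1) (H : ℕ) (hH : 1 ≤ H)
    (re rm : S → A → ℝ) (εr rmax εm : ℝ)
    (hr : ∀ s a, |re s a - rm s a| ≤ εr)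
    (hb : ∀ s a, |re s a| ≤ rmax)
    (hm : ∀ t, 1 ≤ t → t ≤ H - 1 →
      tv (rho f π s₀ a₀ t) (rho fhat π s₀ a₀ t) ≤ εm) :
    J f π s₀ a₀ re γ H - J fhat π s₀ a₀ rm γ H ≤
      (1 - γ ^ H) * εr / (1 - γ) + 2 * rmax * (γ - γ ^ H) * εm / (1 - γ) := by
  have hγ : 1 - γ ≠ 0 := by linarith
  have hB : 0 ≤ rmax := (abs_nonneg _).trans (hb s₀ a₀)
  obtain ⟨n, rfl⟩ : ∃ n, H = n + 1 := ⟨H - 1, by omega⟩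
  simp only [Nat.add_sub_cancel] at hm
  have hsum : ∑ t ∈ Finset.Icc 1 n,
        γ ^ t * ∑ sa : S × A, ((rho f π s₀ a₀ t) sa).toReal * re sa.1 sa.2
      - ∑ t ∈ Finset.Icc 1 n,
        γ ^ t * ∑ sa : S × A, ((rho fhat π s₀ a₀ t) sa).toReal * rm sa.1 sa.2
      ≤ (γ - γ ^ (n + 1)) / (1 - γ) * (εr + 2 * rmax * εm) := by
    rw [← sum_Icc_one_pow hγ1.ne, Finset.sum_mul, ← Finset.sum_sub_distrib]
    refine Finset.sum_le_sum fun t ht => ?_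
    rw [Finset.mem_Icc] at ht
    rw [← mul_sub]
    gcongr
    refine (sum_mul_sub_sum_mul_le _ _ (fun sa : S × A => re sa.1 sa.2)
      (fun sa => rm sa.1 sa.2) rmax εr (fun sa => hb _ _) fun sa => hr _ _).trans ?_
    gcongr
    exact hm t ht.1 ht.2
  have h₀ := (le_abs_self _).trans (hr s₀ a₀)
  have heq : (1 - γ ^ (n + 1)) * εr / (1 - γ) + 2 * rmax * (γ - γ ^ (n + 1)) * εm / (1 - γ)
      = εr + (γ - γ ^ (n + 1)) / (1 - γ) * (εr + 2 * rmax * εm) := by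
    field_simp
    ring
  rw [heq]
  simp only [J, Nat.add_sub_cancel]
  linarith
end

section
/- Let S and A be finite nonempty types, f, f̂ : S → A → PMF S two transition kernels, π : S → PMF A a policy, (s₀, a₀) a fixed initial state-action pair, γ ∈ [0,1) a discount factor, and H ≥ 1 a horizon. Let r_e, r_m : S → A → ℝ. Assume |r_e(s,a) − r_m(s,a)| ≤ ε_r for all s, a, |r_e(s,a)| ≤ r_max for all s, a, and D_TV(ρ_t^f, ρ_t^{f̂}) ≤ ε_m for every t with 1 ≤ t ≤ H−1. Then J^f(r_e) − J^{f̂}(r_m) ≤ ε_r + Σ_{t=1}^{H−1} γ^t · (2·r_max·ε_m + ε_r). -/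
open Finset

/-- Changing both the distribution and the integrand of a finite expectation: the error is controlled
by the total variation distance and the sup distance of the integrands. -/
theorem sum_toReal_mul_sub_le_tv {X : Type*} [Fintype X] (p q : PMF X) (u v : X → ℝ)
    {B ε : ℝ} (hu : ∀ x, |u x| ≤ B) (huv : ∀ x, |u x - v x| ≤ ε) :
    ∑ x, (p x).toReal * u x - ∑ x, (q x).toReal * v x ≤ 2 * B * tv p q + ε := by
  have hq : ∑ x, (q x).toReal = 1 := by
    rw [← ENNReal.toReal_sum fun x _ => q.apply_ne_top x, ← tsum_fintype (L := .unconditional X),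
      q.tsum_coe, ENNReal.toReal_one]
  calc ∑ x, (p x).toReal * u x - ∑ x, (q x).toReal * v x
      = ∑ x, (((p x).toReal - (q x).toReal) * u x + (q x).toReal * (u x - v x)) := by
        rw [← Finset.sum_sub_distrib]
        exact Finset.sum_congr rfl fun x _ => by ring
    _ ≤ ∑ x, (|(p x).toReal - (q x).toReal| * B + (q x).toReal * ε) := by
        refine Finset.sum_le_sum fun x _ => add_le_add ?_ ?_
        · refine (le_abs_self _).trans ?_
          rw [abs_mul]
          exact mul_le_mul_of_nonneg_left (hu x) (abs_nonneg _)
        · exact mul_le_mul_of_nonneg_left ((le_abs_self _).trans (huv x)) ENNReal.toReal_nonneg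
    _ = 2 * B * tv p q + ε := by
        rw [Finset.sum_add_distrib, ← Finset.sum_mul, ← Finset.sum_mul, hq, tv]
        ring

theorem tree_error_bound_sum_form {S A : Type*} [Fintype S] [Fintype A]
    [Nonempty S] [Nonempty A]
    (f fhat : S → A → PMF S) (π : S → PMF A) (s₀ : S) (a₀ : A)
    (γ : ℝ) (hγ0 : 0 ≤ γ) (hγ1 : γ < 1) (H : ℕ) (hH : 1 ≤ H)
    (re rm : S → A → ℝ) (εr rmax εm : ℝ)
    (hr : ∀ s a, |re s a - rm s a| ≤ εr)
    (hb : ∀ s a, |re s a| ≤ rmax)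
    (hm : ∀ t, 1 ≤ t → t ≤ H - 1 →
      tv (rho f π s₀ a₀ t) (rho fhat π s₀ a₀ t) ≤ εm) :
    J f π s₀ a₀ re γ H - J fhat π s₀ a₀ rm γ H ≤
      εr + ∑ t ∈ Finset.Icc 1 (H - 1), γ ^ t * (2 * rmax * εm + εr) := by
  have hB : 0 ≤ rmax := (abs_nonneg _).trans (hb s₀ a₀)
  have hdiff : J f π s₀ a₀ re γ H - J fhat π s₀ a₀ rm γ H = (re s₀ a₀ - rm s₀ a₀) +
      ∑ t ∈ Finset.Icc 1 (H - 1), γ ^ t *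
        (∑ sa : S × A, ((rho f π s₀ a₀ t) sa).toReal * re sa.1 sa.2 -
          ∑ sa : S × A, ((rho fhat π s₀ a₀ t) sa).toReal * rm sa.1 sa.2) := by
    simp only [J, mul_sub, Finset.sum_sub_distrib]
    ring
  rw [hdiff]
  refine add_le_add ((le_abs_self _).trans (hr s₀ a₀)) (Finset.sum_le_sum fun t ht => ?_)
  obtain ⟨h1, h2⟩ := Finset.mem_Icc.mp ht
  refine mul_le_mul_of_nonneg_left ?_ (pow_nonneg hγ0 t)
  refine (sum_toReal_mul_sub_le_tv _ _ (fun sa : S × A => re sa.1 sa.2)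
    (fun sa => rm sa.1 sa.2) (fun sa => hb _ _) (fun sa => hr _ _)).trans ?_
  gcongr
  exact hm t h1 h2
end
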